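/- In the nilHecke algebra nh_n, the element e_n = T_{w_0} · x_1^{n−1} x_2^{n−2} ⋯ x_{n−1}, where T_{w_0} is the product of T-generators corresponding to a reduced expression of the longest element w_0 of S_n, is an idempotent: e_n² = e_n. -/

import Mathlib

namespace NilH

def desc (m : ℕ) : ℕ → List ℕ
  | 0 => []
  | j + 1 => desc m j ++ [m - j]

def full : ℕ → List ℕ
  | 0 => []
  | m + 1 => full m ++ desc m (m + 1)

inductive NF : ℕ → List ℕ → Prop
  | zero : NF 0 []
  | succ (m : ℕ) (c : List ℕ) (j : ℕ) : NF m c → j ≤ m + 1 → NF (m + 1) (c ++ desc m j)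

/-- product of generators along a word -/
def pr {M : Type*} [Monoid M] (g : ℕ → M) (l : List ℕ) : M := (l.map g).prod

section
variable {M : Type*} [Monoid M] (g : ℕ → M)

theorem pr_nil : pr g [] = 1 := by simp [pr]
theorem pr_append (a b : List ℕ) : pr g (a ++ b) = pr g a * pr g b := by simp [pr]
theorem pr_single (a : ℕ) : pr g [a] = g a := by simp [pr]

theorem desc_comm (B : ℕ) (hc : ∀ i j, i < B → j < B → i + 1 < j → g i * g j = g j * g i)
    (m : ℕ) (hm : m < B) (j i : ℕ) (h : i + j < m) :
    pr g (desc m j) * g i = g i * pr g (desc m j) := by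
  induction j with
  | zero => simp [desc, pr_nil]
  | succ j ih =>
    rw [desc, pr_append, pr_single, mul_assoc, ← hc i (m - j) (by omega) (by omega) (by omega),
      ← mul_assoc, ih (by omega), mul_assoc]

theorem desc_braid (B : ℕ) (hc : ∀ i j, i < B → j < B → i + 1 < j → g i * g j = g j * g i)
    (hb : ∀ i, i + 1 < B → g i * g (i + 1) * g i = g (i + 1) * g i * g (i + 1))
    (m : ℕ) (hm : m < B) (j i : ℕ) (hj : j ≤ m + 1) (h : m < i + j) (hi : i + 1 ≤ m) :
    pr g (desc m j) * g (i + 1) = g i * pr g (desc m j) := by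
  induction j with
  | zero => omega
  | succ j ih =>
    by_cases h1 : i + j = m
    · obtain ⟨k, rfl⟩ : ∃ k, j = k + 1 := ⟨j - 1, by omega⟩
      have e1 : m - k = i + 1 := by omega
      have e2 : m - (k + 1) = i := by omega
      simp only [desc, pr_append, pr_single, e1, e2]
      rw [mul_assoc, mul_assoc, ← mul_assoc (g (i+1)), ← hb i (by omega), ← mul_assoc, ← mul_assoc,
        desc_comm g B hc m hm k i (by omega)]
      simp only [mul_assoc]
    · rw [desc, pr_append, pr_single, mul_assoc, hc (m - j) (i+1) (by omega) (by omega) (by omega),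
        ← mul_assoc, ih (by omega) (by omega), mul_assoc]
end

theorem desc_length (m j : ℕ) : (desc m j).length = j := by
  induction j with
  | zero => rfl
  | succ j ih => simp [desc, ih]

theorem NF_length {m : ℕ} {c : List ℕ} (h : NF m c) : c.length ≤ (full m).length := by
  induction h with
  | zero => simp [full]
  | succ m c j _ hj ih => simp [full, desc_length]; omega

theorem full_length (m : ℕ) : (full m).length = (m + 1) * m / 2 := by
  have : (full m).length * 2 = (m + 1) * m := by
    induction m with
    | zero => rfl
    | succ m ih => simp only [full, List.length_append, desc_length]; linarith
  omega

theorem NF_full (m : ℕ) : NF m (full m) := by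
  induction m with
  | zero => exact NF.zero
  | succ m ih => exact NF.succ m _ _ ih le_rfl

/-- Multiplying a normal form on the right by a generator. -/
theorem NF_step {A P : Type*} [Ring A] [Monoid P] (B : ℕ) (T : ℕ → A) (s : ℕ → P)
    (T2 : ∀ i, i < B → T i * T i = 0) (s2 : ∀ i, i < B → s i * s i = 1)
    (Tc : ∀ i j, i < B → j < B → i + 1 < j → T i * T j = T j * T i)
    (Tb : ∀ i, i + 1 < B → T i * T (i + 1) * T i = T (i + 1) * T i * T (i + 1))
    (sc : ∀ i j, i < B → j < B → i + 1 < j → s i * s j = s j * s i)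
    (sb : ∀ i, i + 1 < B → s i * s (i + 1) * s i = s (i + 1) * s i * s (i + 1))
    {m : ℕ} {c : List ℕ} (h : NF m c) (hm : m ≤ B) (i : ℕ) (hi : i < m) :
    ∃ c', NF m c' ∧ pr s c * s i = pr s c' ∧
      ((c'.length = c.length + 1 ∧ pr T c * T i = pr T c') ∨
       (c.length = c'.length + 1 ∧ pr T c * T i = 0)) := by
  induction h generalizing i with
  | zero => omega
  | succ m c j hc hj ih =>
    have key : ∀ k, k < m → pr T (desc m j) * T i = T k * pr T (desc m j) →
        pr s (desc m j) * s i = s k * pr s (desc m j) → 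
        ∃ c', NF (m+1) c' ∧ pr s (c ++ desc m j) * s i = pr s c' ∧
      ((c'.length = (c ++ desc m j).length + 1 ∧ pr T (c ++ desc m j) * T i = pr T c') ∨
       ((c ++ desc m j).length = c'.length + 1 ∧ pr T (c ++ desc m j) * T i = 0)) := by
      intro k hk h1 h2
      obtain ⟨c', n1, n2, n3⟩ := ih (by omega) k hk
      refine ⟨c' ++ desc m j, NF.succ m _ _ n1 hj, ?_, ?_⟩
      · rw [pr_append, pr_append, mul_assoc, h2, ← mul_assoc, n2]
      · simp only [pr_append, mul_assoc, h1, List.length_append]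
        simp only [← mul_assoc]
        rcases n3 with ⟨a, b⟩ | ⟨a, b⟩
        · left; exact ⟨by omega, by rw [b]⟩
        · right; exact ⟨by omega, by rw [b, zero_mul]⟩
    rcases lt_trichotomy (i + j) m with h1 | h1 | h1
    · exact key i (by omega) (desc_comm T B Tc m (by omega) j i h1)
        (desc_comm s B sc m (by omega) j i h1)
    · have e : m - j = i := by omega
      refine ⟨c ++ desc m (j+1), NF.succ m _ _ hc (by omega), ?_, Or.inl ⟨?_, ?_⟩⟩
      · simp [desc, pr_append, pr_single, e, mul_assoc]
      · simp [desc_length]; omega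
      · simp [desc, pr_append, pr_single, e, mul_assoc]
    · by_cases h2 : i + j = m + 1
      · obtain ⟨k, rfl⟩ : ∃ k, j = k + 1 := ⟨j - 1, by omega⟩
        have e : m - k = i := by omega
        refine ⟨c ++ desc m k, NF.succ m _ _ hc (by omega), ?_, Or.inr ⟨?_, ?_⟩⟩
        · simp [desc, pr_append, pr_single, e, mul_assoc, s2 i (by omega)]
        · simp [desc_length]; omega
        · simp [desc, pr_append, pr_single, e, mul_assoc, T2 i (by omega)]
      · obtain ⟨k, rfl⟩ : ∃ k, i = k + 1 := ⟨i - 1, by omega⟩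
        exact key k (by omega) (desc_braid T B Tc Tb m (by omega) j k hj (by omega) (by omega))
          (desc_braid s B sc sb m (by omega) j k hj (by omega) (by omega))

theorem word_NF {A P : Type*} [Ring A] [Monoid P] (B : ℕ) (T : ℕ → A) (s : ℕ → P)
    (T2 : ∀ i, i < B → T i * T i = 0) (s2 : ∀ i, i < B → s i * s i = 1)
    (Tc : ∀ i j, i < B → j < B → i + 1 < j → T i * T j = T j * T i)
    (Tb : ∀ i, i + 1 < B → T i * T (i + 1) * T i = T (i + 1) * T i * T (i + 1))
    (sc : ∀ i j, i < B → j < B → i + 1 < j → s i * s j = s j * s i)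
    (sb : ∀ i, i + 1 < B → s i * s (i + 1) * s i = s (i + 1) * s i * s (i + 1))
    (h0 : ∃ c, NF B c ∧ c.length = 0) (w : List ℕ) (hw : ∀ i ∈ w, i < B) :
    ∃ c, NF B c ∧ pr s w = pr s c ∧ c.length ≤ w.length ∧
      (c.length = w.length → pr T w = pr T c) := by
  induction w using List.reverseRecOn with
  | nil =>
    obtain ⟨c, h, h'⟩ := h0
    have : c = [] := List.length_eq_zero_iff.mp h'
    subst this
    exact ⟨[], h, rfl, le_rfl, fun _ => rfl⟩
  | append_singleton w i ih =>
    obtain ⟨c, n1, n2, n3, n4⟩ := ih (fun k hk => hw k (by simp [hk]))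
    obtain ⟨c', m1, m2, m3⟩ := NF_step B T s T2 s2 Tc Tb sc sb n1 le_rfl i (hw i (by simp))
    refine ⟨c', m1, by rw [pr_append, pr_single, n2, m2], ?_, ?_⟩
    · simp; omega
    · intro hl
      simp at hl
      rcases m3 with ⟨a, b⟩ | ⟨a, b⟩
      · rw [pr_append, pr_single, n4 (by omega), b]
      · omega

theorem NF_empty (m : ℕ) : ∃ c, NF m c ∧ c.length = 0 := by
  induction m with
  | zero => exact ⟨[], NF.zero, rfl⟩
  | succ m ih =>
    obtain ⟨c, h, h'⟩ := ih
    exact ⟨c ++ desc m 0, NF.succ m _ _ h (by omega), by simp [desc, h']⟩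

/-- the adjacent transposition -/
def sw (i : ℕ) : Equiv.Perm ℕ := Equiv.swap i (i + 1)

theorem sw_apply (i k : ℕ) : sw i k = if k = i then i + 1 else if k = i + 1 then i else k := by
  simp [sw, Equiv.swap_apply_def]

theorem sw2 (i : ℕ) : sw i * sw i = 1 := by simp [sw]

theorem swc (i j : ℕ) (h : i + 1 < j) : sw i * sw j = sw j * sw i := by
  ext k
  simp only [Equiv.Perm.mul_apply, sw_apply]
  grind

theorem swb (i : ℕ) : sw i * sw (i + 1) * sw i = sw (i + 1) * sw i * sw (i + 1) := by
  ext k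
  simp only [Equiv.Perm.mul_apply, sw_apply]
  grind

theorem desc_perm (m j k : ℕ) (hj : j ≤ m + 1) :
    pr sw (desc m j) k = if k + j = m + 1 then m + 1 else
      if m + 1 < k + j ∧ k ≤ m + 1 then k - 1 else k := by
  induction j generalizing k with
  | zero => simp [desc, pr_nil]; grind
  | succ j ih =>
    rw [desc, pr_append, pr_single, Equiv.Perm.mul_apply, ih _ (by omega), sw_apply]
    grind

theorem NF_fix {m : ℕ} {c : List ℕ} (h : NF m c) (k : ℕ) (hk : m < k) : pr sw c k = k := by
  induction h generalizing k with
  | zero => simp [pr_nil]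
  | succ m c j hc hj ih =>
    rw [pr_append, Equiv.Perm.mul_apply, desc_perm m j k hj, if_neg (by omega), if_neg (by omega),
      ih k (by omega)]

theorem NF_w0 {m : ℕ} {c : List ℕ} (h : NF m c) (hp : ∀ k ≤ m, pr sw c k = m - k) :
    c = full m := by
  induction h with
  | zero => rfl
  | succ m c j hc hj ih =>
    have h1 : pr sw (c ++ desc m j) (m + 1 - j) = m + 1 := by
      rw [pr_append, Equiv.Perm.mul_apply, desc_perm m j _ hj, if_pos (by omega),
        NF_fix hc _ (by omega)]
    rw [hp _ (by omega)] at h1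
    have : j = m + 1 := by omega
    subst this
    rw [full, ih]
    intro k hk
    have h2 := hp (k + 1) (by omega)
    rw [pr_append, Equiv.Perm.mul_apply, desc_perm m _ _ hj, if_neg (by omega),
      if_pos (by omega)] at h2
    simpa using h2

theorem mon_step {A S : Type*} [Ring A] [CommMonoid S] (φ : S →* A) (n : ℕ) (X : ℕ → S)
    (D t : A) (i : ℕ) (hi : i + 1 < n) (hD : D * t = 0)
    (h1 : ∀ k, k < n → k ≠ i → k ≠ i + 1 → t * φ (X k) = φ (X k) * t)
    (h2 : t * φ (X i) - φ (X (i+1)) * t = 1) (h3 : t * φ (X (i+1)) - φ (X i) * t = -1)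
    (a b : ℕ → ℕ) (hb : b i = b (i + 1)) (ha : a i = b i + 1) (hab : ∀ k, k ≠ i → a k = b k) :
    D * φ (∏ k ∈ Finset.range n, X k ^ a k) * t = D * φ (∏ k ∈ Finset.range n, X k ^ b k) := by
  have hi0 : i ∈ Finset.range n := by simp; omega
  have hi1 : i + 1 ∈ (Finset.range n).erase i := by simp; omega
  have e1 : ∏ k ∈ Finset.range n, X k ^ a k = (∏ k ∈ Finset.range n, X k ^ b k) * X i := by
    rw [← Finset.mul_prod_erase _ _ hi0, ← Finset.mul_prod_erase _ _ hi0, ha, pow_succ,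
      Finset.prod_congr rfl (fun k hk => by rw [hab k (Finset.ne_of_mem_erase hk)])]
    ac_rfl
  have e2 : Commute t (φ (∏ k ∈ Finset.range n, X k ^ b k)) := by
    let N : Submonoid S := (Submonoid.centralizer {t}).comap φ
    have hN : ∀ s, s ∈ N ↔ t * φ s = φ s * t := by
      intro s
      simp [N, Submonoid.mem_centralizer_iff]
    refine (hN _).1 ?_
    rw [← Finset.mul_prod_erase _ _ hi0, ← Finset.mul_prod_erase _ _ hi1, hb, ← mul_assoc,
      ← mul_pow, ← hb]
    refine N.mul_mem (N.pow_mem ?_ _) (N.prod_mem ?_)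
    · rw [hN, map_mul]
      have h2' : t * φ (X i) = φ (X (i+1)) * t + 1 := by rw [← h2]; abel
      have h3' : t * φ (X (i+1)) = φ (X i) * t - 1 := by rw [sub_eq_add_neg, ← h3]; abel
      have h4 : φ (X i) * φ (X (i+1)) = φ (X (i+1)) * φ (X i) := by
        rw [← map_mul, mul_comm, map_mul]
      rw [← mul_assoc, h2', add_mul, mul_assoc, h3', one_mul, h4, mul_sub, mul_one, mul_assoc]
      abel
    · intro k hk
      simp only [Finset.mem_erase, Finset.mem_range] at hk
      exact N.pow_mem ((hN _).2 (h1 k hk.2.2 hk.2.1 hk.1)) _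
  have h3' : φ (X i) * t = t * φ (X (i+1)) + 1 := by
    have := h3
    rw [sub_eq_iff_eq_add] at this
    rw [this]; abel
  rw [e1, map_mul, mul_assoc, mul_assoc, h3', mul_add, mul_one, ← mul_assoc _ t, ← e2.eq, mul_add,
    mul_assoc t, ← mul_assoc D, hD, zero_mul, zero_add]

theorem mon_desc {A S : Type*} [Ring A] [CommMonoid S] (φ : S →* A) (n : ℕ) (X : ℕ → S)
    (D : A) (T : ℕ → A)
    (step : ∀ i, i + 1 < n → ∀ a b : ℕ → ℕ, b i = b (i + 1) → a i = b i + 1 →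
      (∀ k, k ≠ i → a k = b k) →
      D * φ (∏ k ∈ Finset.range n, X k ^ a k) * T i = D * φ (∏ k ∈ Finset.range n, X k ^ b k))
    (m : ℕ) (hm : m + 1 < n) (j : ℕ) (hj : j ≤ m + 1) :
    D * φ (∏ k ∈ Finset.range n, X k ^ (n - 1 - max k m)) * pr T (desc m j) =
    D * φ (∏ k ∈ Finset.range n, X k ^ (n - 1 - max k m - if m < k + j ∧ k ≤ m then 1 else 0)) := by
  induction j with
  | zero =>
    have : ∀ k, (if m < k + 0 ∧ k ≤ m then 1 else 0) = 0 := by intro k; rw [if_neg (by omega)]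
    simp only [this, desc, pr_nil, mul_one, Nat.sub_zero]
  | succ j ih =>
    rw [desc, pr_append, pr_single, ← mul_assoc, ih (by omega)]
    apply step (m - j) (by omega)
    · grind
    · grind
    · intro k hk; grind

theorem mon_full {A S : Type*} [Ring A] [CommMonoid S] (φ : S →* A) (n : ℕ) (X : ℕ → S)
    (D : A) (T : ℕ → A)
    (step : ∀ i, i + 1 < n → ∀ a b : ℕ → ℕ, b i = b (i + 1) → a i = b i + 1 →
      (∀ k, k ≠ i → a k = b k) →
      D * φ (∏ k ∈ Finset.range n, X k ^ a k) * T i = D * φ (∏ k ∈ Finset.range n, X k ^ b k))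
    (m : ℕ) (hm : m < n) :
    D * φ (∏ k ∈ Finset.range n, X k ^ (n - 1 - k)) * pr T (full m) =
    D * φ (∏ k ∈ Finset.range n, X k ^ (n - 1 - max k m)) := by
  induction m with
  | zero => simp [full, pr_nil]
  | succ m ih =>
    rw [full, pr_append, ← mul_assoc, ih (by omega), mon_desc φ n X D T step m (by omega) _ le_rfl]
    congr 2
    apply Finset.prod_congr rfl
    intro k _
    congr 1
    grind

theorem exists_comm.{u} {A : Type u} [Ring A] (n : ℕ) (x : Fin n → A)
    (hxx : ∀ i j, x i * x j = x j * x i) :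
    ∃ (S : Type u) (_ : CommMonoid S) (φ : S →* A) (X : ℕ → S),
      ∀ k (h : k < n), φ (X k) = x ⟨k, h⟩ := by
  have hc : IsMulCommutative (Submonoid.closure (Set.range x)) :=
    Submonoid.isMulCommutative_closure A (by
      rintro _ ⟨i, rfl⟩ _ ⟨j, rfl⟩
      exact hxx i j)
  refine ⟨Submonoid.closure (Set.range x),
    { (inferInstance : Monoid (Submonoid.closure (Set.range x))) with
      mul_comm := fun a b => hc.is_comm.comm a b },
    { toFun := fun s => s, map_one' := rfl, map_mul' := fun _ _ => rfl },
    fun k => if h : k < n then ⟨x ⟨k, h⟩, Submonoid.subset_closure ⟨_, rfl⟩⟩ else 1, ?_⟩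
  intro k h
  simp [dif_pos h]

end NilH


/-- In any ring with elements `T_0,…,T_{n−2}`, `x_0,…,x_{n−1}` satisfying the nilHecke
relations (0-based indexing), the element
`e_n = T_{w_0} · x_0^{n−1} x_1^{n−2} ⋯ x_{n−2}` is an idempotent, where `T_{w_0}` is the
product of `T`-generators along a reduced expression `w` of the longest element `w_0` of
`S_n` (encoded by: the word has length `n(n−1)/2` and its product of adjacent
transpositions is the order-reversing permutation `j ↦ n−1−j`). -/
theorem nilHecke_longest_idempotent
    (n : ℕ) (A : Type*) [Ring A] (T : ℕ → A) (x : Fin n → A)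
    (hT2 : ∀ i, i + 1 < n → T i * T i = 0)
    (hTT : ∀ i j, i + 1 < n → j + 1 < n → i + 1 < j → T i * T j = T j * T i)
    (hbraid : ∀ i, i + 2 < n → T i * T (i + 1) * T i = T (i + 1) * T i * T (i + 1))
    (hxx : ∀ i j : Fin n, x i * x j = x j * x i)
    (hTx : ∀ i, i + 1 < n → ∀ j : Fin n, (j : ℕ) ≠ i → (j : ℕ) ≠ i + 1 →
      T i * x j = x j * T i)
    (hTxi : ∀ i (h : i + 1 < n),
      T i * x ⟨i, Nat.lt_of_succ_lt h⟩ - x ⟨i + 1, h⟩ * T i = 1)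
    (hTxi1 : ∀ i (h : i + 1 < n),
      T i * x ⟨i + 1, h⟩ - x ⟨i, Nat.lt_of_succ_lt h⟩ * T i = -1)
    (w : List ℕ) (hw : ∀ i ∈ w, i + 1 < n)
    (hred : w.length = n * (n - 1) / 2)
    (hw0 : ∀ j < n, ((w.map (fun i => Equiv.swap i (i + 1))).prod : Equiv.Perm ℕ) j
      = n - 1 - j)
    (e : A)
    (he : e = (w.map T).prod *
      ((List.finRange n).map (fun i => x i ^ (n - 1 - (i : ℕ)))).prod) :
    e * e = e := by
  have hred' := hred
  rcases n with _ | m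
  · have : w = [] := List.eq_nil_iff_forall_not_mem.mpr (fun i hi => by have := hw i hi; omega)
    subst this
    simp [he]
  have Tb := fun i (h : i + 1 < m) => hbraid i (by omega)
  have Tc := fun i j (h1 : i < m) (h2 : j < m) h => hTT i j (by omega) (by omega) h
  have T2 := fun i (h : i < m) => hT2 i (by omega)
  have hstep := fun {c} (h : NilH.NF m c) i hi => NilH.NF_step m T NilH.sw T2
    (fun i _ => NilH.sw2 i) Tc Tb (fun i j _ _ h => NilH.swc i j h) (fun i _ => NilH.swb i)
    h le_rfl i hi
  obtain ⟨c, c1, c2, c3, c4⟩ := NilH.word_NF m T NilH.sw T2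
    (fun i _ => NilH.sw2 i) Tc Tb (fun i j _ _ h => NilH.swc i j h) (fun i _ => NilH.swb i)
    (NilH.NF_empty m) w (fun i hi => by have := hw i hi; omega)
  have hcf : c = NilH.full m := by
    apply NilH.NF_w0 c1
    intro k hk
    rw [← c2]
    exact hw0 k (by omega)
  subst hcf
  have hwT : (w.map T).prod = NilH.pr T (NilH.full m) := by
    apply c4
    rw [NilH.full_length, hred]
    rfl
  set D := NilH.pr T (NilH.full m) with hDdef
  have hD : ∀ i, i < m → D * T i = 0 := by
    intro i hi
    obtain ⟨c', d1, d2, ⟨d3, d4⟩ | ⟨d3, d4⟩⟩ := hstep c1 i hi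
    · have := NilH.NF_length d1
      omega
    · exact d4
  obtain ⟨S, _, φ, X, hX⟩ := NilH.exists_comm (m + 1) x hxx
  have hP : ((List.finRange (m+1)).map (fun i => x i ^ (m + 1 - 1 - (i : ℕ)))).prod =
      φ (∏ k ∈ Finset.range (m+1), X k ^ (m + 1 - 1 - k)) := by
    rw [← Fin.prod_univ_eq_prod_range (fun k => X k ^ (m + 1 - 1 - k)), Fin.prod_univ_def,
      map_list_prod, List.map_map]
    congr 1
    apply List.map_congr_left
    intro i _
    simp only [Function.comp, map_pow, hX _ i.2]
  have main := NilH.mon_full φ (m+1) X D T (fun i hi a b h1 h2 h3 =>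
    NilH.mon_step φ (m+1) X D (T i) i hi (hD i (by omega))
      (fun k hk n1 n2 => by rw [hX k hk]; exact hTx i hi _ n1 n2)
      (by rw [hX _ hi, hX i (by omega)]; exact hTxi i hi)
      (by rw [hX _ hi, hX i (by omega)]; exact hTxi1 i hi) a b h1 h2 h3) m (by omega)
  have h1 : ∏ k ∈ Finset.range (m+1), X k ^ (m + 1 - 1 - max k m) = 1 := by
    apply Finset.prod_eq_one
    intro k _
    rw [show m + 1 - 1 - max k m = 0 by omega, pow_zero]
  rw [h1, map_one, mul_one, ← hDdef] at main
  rw [he, hwT, hP, ← mul_assoc, main]
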